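/- Let n ≥ 1 and let v₁, …, vₙ : ℝ² → ℝ be continuous functions with vᵢ(0,0) = 0 for all i. Then the binary operation on ℝ³ defined by (x₁,y₁,z₁) ∗ (x₂,y₂,z₂) = (x₁+x₂, y₁+y₂ − x₂·v₁(x₁,z₁) + (x₂²/2!)·v₂(x₁,z₁) + ⋯ + ((−1)ⁿ x₂ⁿ/n!)·vₙ(x₁,z₁), z₁+z₂) is a topological loop multiplication with identity (0,0,0): the operation is continuous, (0,0,0) is a two-sided identity, and for all a, b ∈ ℝ³ each of the equations a ∗ y = b and x ∗ a = b has exactly one solution. -/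

import Mathlib

open Finset

/-- The loop multiplication on `ℝ³` determined by continuous functions
`v₁, …, vₙ : ℝ² → ℝ`:
`(x₁,y₁,z₁) ∗ (x₂,y₂,z₂) =
 (x₁+x₂, y₁+y₂ + Σ_{i=1}^{n} ((−1)^i x₂^i / i!)·vᵢ(x₁,z₁), z₁+z₂)`. -/
noncomputable def loopMul (n : ℕ) (v : ℕ → ℝ × ℝ → ℝ) (p q : ℝ × ℝ × ℝ) : ℝ × ℝ × ℝ :=
  (p.1 + q.1,
    p.2.1 + q.2.1 +
      ∑ i ∈ Icc 1 n, ((-1) ^ i * q.1 ^ i / (Nat.factorial i : ℝ)) * v i (p.1, p.2.2),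
    p.2.2 + q.2.2)

/-- For `n ≥ 1` and continuous `v₁, …, vₙ : ℝ² → ℝ` with `vᵢ(0,0) = 0`, the operation
`loopMul n v` is a topological loop multiplication on `ℝ³` with identity `(0,0,0)`:
it is continuous, `(0,0,0)` is a two-sided identity, and the equations `a ∗ y = b` and
`x ∗ a = b` have exactly one solution for all `a, b`. -/
theorem loopMul_is_topological_loop (n : ℕ) (hn : 1 ≤ n) (v : ℕ → ℝ × ℝ → ℝ)
    (hv : ∀ i, Continuous (v i)) (hv0 : ∀ i, v i (0, 0) = 0) :
    Continuous (fun p : (ℝ × ℝ × ℝ) × (ℝ × ℝ × ℝ) => loopMul n v p.1 p.2) ∧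
    (∀ a : ℝ × ℝ × ℝ, loopMul n v (0, 0, 0) a = a ∧ loopMul n v a (0, 0, 0) = a) ∧
    (∀ a b : ℝ × ℝ × ℝ,
      (∃! y : ℝ × ℝ × ℝ, loopMul n v a y = b) ∧
      (∃! x : ℝ × ℝ × ℝ, loopMul n v x a = b)) := by
  refine ⟨?_, fun a => ⟨?_, ?_⟩, fun a b => ⟨?_, ?_⟩⟩
  · unfold loopMul
    fun_prop
  · simp [loopMul, hv0]
  · have hsum : ∑ i ∈ Icc 1 n,
        ((-1) ^ i * (0 : ℝ) ^ i / (Nat.factorial i : ℝ)) * v i (a.1, a.2.2) = 0 := by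
      refine sum_eq_zero fun i hi => ?_
      have hi0 : i ≠ 0 := Nat.one_le_iff_ne_zero.mp (mem_Icc.mp hi).1
      simp [hi0]
    simp only [loopMul, hsum, add_zero]
  · refine ⟨(b.1 - a.1, b.2.1 - a.2.1 - ∑ i ∈ Icc 1 n,
      ((-1) ^ i * (b.1 - a.1) ^ i / (Nat.factorial i : ℝ)) * v i (a.1, a.2.2),
      b.2.2 - a.2.2), ?_, ?_⟩
    · ext <;> simp only [loopMul] <;> ring
    · rintro ⟨y₁, y₂, y₃⟩ rfl
      simp only [loopMul, add_sub_cancel_left]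
      ext <;> simp only
      ring
  · refine ⟨(b.1 - a.1, b.2.1 - a.2.1 - ∑ i ∈ Icc 1 n,
      ((-1) ^ i * a.1 ^ i / (Nat.factorial i : ℝ)) * v i (b.1 - a.1, b.2.2 - a.2.2),
      b.2.2 - a.2.2), ?_, ?_⟩
    · ext <;> simp only [loopMul] <;> ring
    · rintro ⟨x₁, x₂, x₃⟩ rfl
      simp only [loopMul, add_sub_cancel_right]
      ext <;> simp only
      ring
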